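/- Let k ≥ 3 and let R ⊆ (Fin k → ZMod 2). Assume: (i) R is not affine-closed; (ii) for every index i ∈ Fin k and every α ∈ ZMod 2, the set {x ∈ R : x i = α} is affine-closed; (iii) for every index i ∈ Fin k, the image of R under the restriction map deleting coordinate i (i.e., the image of R under x ↦ (x restricted to {l : Fin k // l ≠ i})) is affine-closed as a subset of ({l // l ≠ i} → ZMod 2). Then either there exist distinct indices i ≠ j such that {x ∈ R : x i = x j} is not affine-closed, or there exist distinct indices i ≠ j and a vector d : Fin k → ZMod 2 such that {x ∈ R : ∀ l, l ≠ i → l ≠ j → x l = d l} is not affine-closed. -/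

import Mathlib

/-- A set `S` is affine-closed if it is closed under `a + b + c`. -/
def AffineClosed {α : Type*} [Add α] (S : Set α) : Prop :=
  ∀ a ∈ S, ∀ b ∈ S, ∀ c ∈ S, a + b + c ∈ S

/-- Flipping the coordinates of `s` in `T`. -/
def flipOn {k : ℕ} (s : Fin k → ZMod 2) (T : Finset (Fin k)) : Fin k → ZMod 2 :=
  fun l => s l + if l ∈ T then 1 else 0

theorem exists_eq_flipOn {k : ℕ} (s x : Fin k → ZMod 2) : ∃ T, x = flipOn s T := by
  refine ⟨Finset.univ.filter fun l => x l ≠ s l, funext fun l => ?_⟩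
  simp only [flipOn, Finset.mem_filter, Finset.mem_univ, true_and]
  generalize x l = p
  generalize s l = q
  revert p q
  decide

theorem sum_flipOn {k : ℕ} (s : Fin k → ZMod 2) (T : Finset (Fin k)) :
    ∑ l, flipOn s T l = ∑ l, s l + T.card := by
  simp [flipOn, Finset.sum_add_distrib]

theorem flipOn_add_add {k : ℕ} (s : Fin k → ZMod 2) {A B C D : Finset (Fin k)}
    (h : ∀ l, l ∈ D ↔ Xor (l ∈ A) (Xor (l ∈ B) (l ∈ C))) :
    flipOn s A + flipOn s B + flipOn s C = flipOn s D := by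
  funext l
  simp only [flipOn, Pi.add_apply, h l]
  generalize s l = q
  by_cases hA : l ∈ A <;> by_cases hB : l ∈ B <;> by_cases hC : l ∈ C <;>
    simp only [hA, hB, hC, xor_true, xor_false, not_true_eq_false, not_false_eq_true, id_eq,
      if_true, if_false] <;> revert q <;> decide

/-- If the coordinate sections of `R` are affine-closed and `R` contains every vector at
distance one from `s` but none at distance zero or two, then every vector in `R` is at odd
distance from `s`. -/
theorem odd_card_of_flipOn_mem {k : ℕ} {R : Set (Fin k → ZMod 2)} {s : Fin k → ZMod 2}
    (hR : ∀ (i : Fin k) (α : ZMod 2), AffineClosed {x ∈ R | x i = α})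
    (h₀ : flipOn s ∅ ∉ R) (h₁ : ∀ i, flipOn s {i} ∈ R)
    (h₂ : ∀ i j, i ≠ j → flipOn s {i, j} ∉ R) (T : Finset (Fin k)) (hT : flipOn s T ∈ R) :
    Odd T.card := by
  have pin {A B C : Finset (Fin k)} (m : Fin k) (hAB : m ∈ A ↔ m ∈ B) (hAC : m ∈ A ↔ m ∈ C)
      (hA : flipOn s A ∈ R) (hB : flipOn s B ∈ R) (hC : flipOn s C ∈ R) :
      flipOn s A + flipOn s B + flipOn s C ∈ R :=
    (hR m (flipOn s A m) _ ⟨hA, rfl⟩ _ ⟨hB, by simp [flipOn, hAB]⟩ _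
      ⟨hC, by simp [flipOn, hAC]⟩).1
  induction hn : T.card using Nat.strong_induction_on generalizing T with
  | _ n ih =>
    match n, hn with
    | 0, hn => exact absurd (Finset.card_eq_zero.mp hn ▸ hT) h₀
    | 1, _ => exact odd_one
    | 2, hn =>
      obtain ⟨i, j, hij, rfl⟩ := Finset.card_eq_two.mp hn
      exact absurd hT (h₂ i j hij)
    | 3, _ => decide
    | r + 4, hn =>
      obtain ⟨i, A, hi, rfl, hA⟩ := Finset.card_eq_succ.mp hn
      obtain ⟨j, B, hj, rfl, hB⟩ := Finset.card_eq_succ.mp hA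
      obtain ⟨m, C, hm, rfl, hC⟩ := Finset.card_eq_succ.mp hB
      obtain ⟨n, D, hn', rfl, -⟩ := Finset.card_eq_succ.mp hC
      simp only [Finset.mem_insert, not_or] at hi hj hm
      have h₃ : flipOn s {i, j, m} ∈ R := by
        rw [← flipOn_add_add s (A := {i}) (B := {j}) (C := {m})
          (by intro l; simp only [Finset.mem_insert, Finset.mem_singleton, Xor]; grind)]
        exact pin n (by grind) (by grind) (h₁ i) (h₁ j) (h₁ m)
      have hU : flipOn s (insert m (insert n D)) ∈ R := by
        rw [← flipOn_add_add s (A := insert i (insert j (insert m (insert n D))))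
          (B := {m}) (C := {i, j, m})
          (by intro l; simp only [Finset.mem_insert, Finset.mem_singleton, Xor]; grind)]
        exact pin m (by simp) (by simp) hT (h₁ m) h₃
      have := ih (r + 2) (by omega) _ hU hB
      grind

theorem stmt0 (k : ℕ) (hk : 3 ≤ k) (R : Set (Fin k → ZMod 2))
    (h1 : ¬ AffineClosed R)
    (h2 : ∀ (i : Fin k) (α : ZMod 2), AffineClosed {x ∈ R | x i = α})
    (h3 : ∀ i : Fin k,
      AffineClosed ((fun (x : Fin k → ZMod 2) (l : {l : Fin k // l ≠ i}) => x l.1) '' R)) :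
    (∃ i j : Fin k, i ≠ j ∧ ¬ AffineClosed {x ∈ R | x i = x j}) ∨
    (∃ i j : Fin k, i ≠ j ∧ ∃ d : Fin k → ZMod 2,
      ¬ AffineClosed {x ∈ R | ∀ l, l ≠ i → l ≠ j → x l = d l}) := by
  right
  simp only [AffineClosed, not_forall] at h1
  obtain ⟨a, ha, b, hb, c, hc, hs⟩ := h1
  generalize hsum : a + b + c = s at hs
  have hflip : flipOn s ∅ = s := by funext l; simp [flipOn]
  have h₁ (i : Fin k) : flipOn s {i} ∈ R := by
    obtain ⟨y, hy, hys⟩ := h3 i _ ⟨a, ha, rfl⟩ _ ⟨b, hb, rfl⟩ _ ⟨c, hc, rfl⟩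
    obtain ⟨T, rfl⟩ := exists_eq_flipOn s y
    have hT (l : Fin k) (hl : l ≠ i) : l ∉ T := by
      have := congrFun hys ⟨l, hl⟩
      intro hlT
      simp [← hsum, flipOn, hlT] at this
    rcases Finset.subset_singleton_iff.mp
      (fun l hl => Finset.mem_singleton.mpr (by_contra fun h => hT l h hl) : T ⊆ {i}) with
      rfl | rfl
    · exact absurd (hflip ▸ hy) hs
    · exact hy
  by_contra hcon
  simp only [not_exists, not_and, not_not] at hcon
  have h₂ (i j : Fin k) (hij : i ≠ j) : flipOn s {i, j} ∉ R := by
    intro hmem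
    refine hs ?_
    have := hcon i j hij s _ ⟨h₁ i, ?_⟩ _ ⟨h₁ j, ?_⟩ _ ⟨hmem, ?_⟩
    · rw [flipOn_add_add s (D := ∅)
        (by intro l; simp only [Finset.mem_insert, Finset.mem_singleton, Xor]; grind),
        hflip] at this
      exact this.1
    all_goals intro l hi hj; simp [flipOn, hi, hj]
  have hodd (x : Fin k → ZMod 2) (hx : x ∈ R) : ∑ l, x l = ∑ l, s l + 1 := by
    obtain ⟨T, rfl⟩ := exists_eq_flipOn s x
    rw [sum_flipOn, ZMod.natCast_eq_one_iff_odd.mpr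
      (odd_card_of_flipOn_mem h2 (by rwa [hflip]) h₁ h₂ T hx)]
  have hsum' : ∑ l, a l + ∑ l, b l + ∑ l, c l = ∑ l, s l := by
    simp [← hsum, Finset.sum_add_distrib]
  rw [hodd a ha, hodd b hb, hodd c hc] at hsum'
  generalize ∑ l, s l = q at hsum'
  revert q
  decide
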